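/- arXiv:2203.16233 — 2 statements merged into one kernel-verified Lean document; each statement's English description precedes it below -/
import Mathlib

section
/- For a fixed sample x_1,…,x_n ∈ ℝ^p at which the sample covariance matrix S_0 has distinct eigenvalues s_1 > ⋯ > s_p, the empirically centered PCA reconstructions x̂_i = t_0 + P_k(x_i − t_0) are differentiable functions of the data entries and satisfy the exact identity Σ_{i=1}^n Σ_{j=1}^p ∂x̂_{ij}/∂x_{ij} = (n−1)k + p + Σ_{j=1}^k Σ_{ℓ=k+1}^p (s_j + s_ℓ)/(s_j − s_ℓ). -/
open Matrix Filter Finset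

/-- `P` is the orthogonal projection onto the span of eigenvectors of `A` corresponding to its
`k` largest eigenvalues, where `A` has `p` distinct eigenvalues. -/
def IsTopProj (p k : ℕ) (A P : Matrix (Fin p) (Fin p) ℝ) : Prop :=
  ∃ (u : Fin p → Fin p → ℝ) (s : Fin p → ℝ),
    (∀ a b, u a ⬝ᵥ u b = if a = b then (1 : ℝ) else 0) ∧ StrictAnti s ∧
    (∀ ℓ, A.mulVec (u ℓ) = s ℓ • u ℓ) ∧
    P = ∑ ℓ ∈ Finset.univ.filter (fun ℓ : Fin p => (ℓ : ℕ) < k), Matrix.vecMulVec (u ℓ) (u ℓ)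

open Classical in
/-- The orthogonal projection onto the span of eigenvectors of `A` corresponding to its `k`
largest eigenvalues (well defined whenever the eigenvalues of `A` are distinct). -/
noncomputable def topProj (p k : ℕ) (A : Matrix (Fin p) (Fin p) ℝ) :
    Matrix (Fin p) (Fin p) ℝ :=
  if h : ∃ P, IsTopProj p k A P then h.choose else 0

/-- The sample mean `t₀` of the sample `X`. -/
noncomputable def sampleMean (n p : ℕ) (X : Fin n → Fin p → ℝ) : Fin p → ℝ :=
  (n : ℝ)⁻¹ • ∑ ℓ, X ℓ

/-- The sample covariance matrix `S₀` of the sample `X`. -/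
noncomputable def sampleCov (n p : ℕ) (X : Fin n → Fin p → ℝ) : Matrix (Fin p) (Fin p) ℝ :=
  (n : ℝ)⁻¹ • ∑ ℓ, Matrix.vecMulVec (X ℓ - sampleMean n p X) (X ℓ - sampleMean n p X)

/-- The perturbed sample, in which `x i` is replaced by `x i + ε • e j`. -/
noncomputable def perturb (n p : ℕ) (X : Fin n → Fin p → ℝ) (i : Fin n) (j : Fin p) (ε : ℝ) :
    Fin n → Fin p → ℝ :=
  Function.update X i (X i + ε • (Pi.single j 1 : Fin p → ℝ))

/-- The empirically centered PCA reconstruction `x̂ᵢ = t₀ + P_k (xᵢ − t₀)` of the `i`-th point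
of the sample `X`, where `P_k` is the projection onto the span of the first `k` eigenvectors of
the sample covariance matrix of `X`. -/
noncomputable def recon (n p k : ℕ) (X : Fin n → Fin p → ℝ) (i : Fin n) : Fin p → ℝ :=
  sampleMean n p X + (topProj p k (sampleCov n p X)).mulVec (X i - sampleMean n p X)

open Topology

/-- The diagonal matrix projecting onto the first `k` coordinates. -/
def headProj (p k : ℕ) : Matrix (Fin p) (Fin p) ℝ :=
  diagonal fun a => if (a : ℕ) < k then 1 else 0

/-- A finite strictly decreasing family of reals has a positive gap. -/
lemma StrictAnti.exists_gap {p : ℕ} {s : Fin p → ℝ} (hs : StrictAnti s) :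
    ∃ δ > 0, ∀ a b, a < b → 2 * δ < s a - s b := by
  have h : ∀ᶠ δ in 𝓝[>] (0 : ℝ), ∀ a b, a < b → 2 * δ < s a - s b := by
    simp only [eventually_all]
    intro a b hab
    have hc : Tendsto (fun δ : ℝ => 2 * δ) (𝓝[>] 0) (𝓝 0) := by
      have : ContinuousAt (fun δ : ℝ => 2 * δ) 0 := by fun_prop
      simpa [ContinuousAt] using this.mono_left nhdsWithin_le_nhds
    exact hc.eventually_lt_const (sub_pos.2 (hs hab))
  obtain ⟨δ, h1, h2⟩ := (h.and self_mem_nhdsWithin).exists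
  exact ⟨δ, h2, h1⟩

lemma lt_abs_sub_of_gap {p : ℕ} {s : Fin p → ℝ} {δ : ℝ}
    (hgap : ∀ a b, a < b → 2 * δ < s a - s b) {a b : Fin p} (hab : a ≠ b) :
    2 * δ < |s a - s b| := by
  rcases lt_or_gt_of_ne hab with h | h
  · exact (hgap a b h).trans_le (le_abs_self _)
  · rw [abs_sub_comm]
    exact (hgap b a h).trans_le (le_abs_self _)

/-- A matrix close to a diagonal matrix with distinct entries has an eigenvalue close to each of
these entries. -/
lemma eventually_exists_eigenvector {p : ℕ} {s : Fin p → ℝ} {δ : ℝ} (hδ : 0 < δ)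
    (hgap : ∀ a b, a < b → 2 * δ < s a - s b) (a : Fin p) :
    ∀ᶠ B in 𝓝 (diagonal s : Matrix (Fin p) (Fin p) ℝ),
      ∃ t, |t - s a| < δ ∧ ∃ w, w ≠ 0 ∧ B *ᵥ w = t • w := by
  set η := δ / 2 with hη
  have hη0 : 0 < η := by positivity
  have hc (y : ℝ) : Continuous fun B : Matrix (Fin p) (Fin p) ℝ => (diagonal (fun _ => y) - B).det :=
    Continuous.matrix_det (continuous_const.sub continuous_id)
  have hneg : (diagonal (fun _ => s a + η) - diagonal s).det
      * (diagonal (fun _ => s a - η) - diagonal s).det < 0 := by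
    simp only [diagonal_sub, det_diagonal]
    rw [← Finset.prod_mul_distrib, ← Finset.mul_prod_erase _ _ (Finset.mem_univ a)]
    refine mul_neg_of_neg_of_pos (by nlinarith) (Finset.prod_pos fun b hb => ?_)
    have h1 := lt_abs_sub_of_gap hgap (Finset.ne_of_mem_erase hb).symm
    have h2 : η ^ 2 < (s a - s b) ^ 2 := sq_lt_sq.2 (by rw [abs_of_pos hη0]; linarith)
    nlinarith
  have hev := ((hc (s a + η)).mul (hc (s a - η))).continuousAt.eventually_lt
    (continuousAt_const (y := (0 : ℝ))) hneg
  filter_upwards [hev] with B hB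
  have hcont : Continuous fun y : ℝ => (diagonal (fun _ => y) - B).det :=
    Continuous.matrix_det (by fun_prop)
  have hroot : ∃ t ∈ Set.Icc (s a - η) (s a + η), (diagonal (fun _ => t) - B).det = 0 := by
    have hle : s a - η ≤ s a + η := by linarith
    rcases mul_neg_iff.1 hB with h | h
    · exact intermediate_value_Icc hle hcont.continuousOn ⟨h.2.le, h.1.le⟩
    · exact intermediate_value_Icc' hle hcont.continuousOn ⟨h.1.le, h.2.le⟩
  obtain ⟨t, ht, hdet⟩ := hroot
  obtain ⟨w, hw, hBw⟩ := exists_mulVec_eq_zero_iff.2 hdet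
  refine ⟨t, ?_, w, hw, ?_⟩
  · rw [abs_lt]; constructor <;> linarith [ht.1, ht.2]
  · rw [sub_mulVec, sub_eq_zero] at hBw
    rw [← hBw]
    ext i
    simp [mulVec_diagonal]

/-- Eigenvectors of a symmetric matrix for distinct eigenvalues are orthogonal. -/
lemma dotProduct_eq_zero_of_eigenvectors {p : ℕ} {B : Matrix (Fin p) (Fin p) ℝ} (hB : B.IsSymm)
    {v w : Fin p → ℝ} {c d : ℝ} (hv : B *ᵥ v = c • v) (hw : B *ᵥ w = d • w) (hcd : c ≠ d) :
    v ⬝ᵥ w = 0 := by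
  have h : (B *ᵥ v) ⬝ᵥ w = v ⬝ᵥ (B *ᵥ w) := by
    rw [dotProduct_mulVec, ← mulVec_transpose, hB.eq]
  rw [hv, hw, smul_dotProduct, dotProduct_smul, smul_eq_mul, smul_eq_mul] at h
  have : (c - d) * (v ⬝ᵥ w) = 0 := by linarith
  exact (mul_eq_zero.1 this).resolve_left (sub_ne_zero.2 hcd)

lemma conj_eq_diagonal_of_eigenvectors {p : ℕ} {A : Matrix (Fin p) (Fin p) ℝ}
    {u : Fin p → Fin p → ℝ} {s : Fin p → ℝ}
    (hu : ∀ a b, u a ⬝ᵥ u b = if a = b then (1 : ℝ) else 0)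
    (hA : ∀ l, A *ᵥ u l = s l • u l) :
    of u * (of u)ᵀ = 1 ∧ of u * A * (of u)ᵀ = diagonal s := by
  constructor
  · ext a b
    exact (hu a b).trans (one_apply).symm
  · ext a b
    rw [Matrix.mul_assoc]
    have : (of u * (A * (of u)ᵀ)) a b = u a ⬝ᵥ (A *ᵥ u b) := rfl
    rw [this, hA, dotProduct_smul, hu, diagonal_apply]
    split_ifs with h <;> simp [h]

/-- A symmetric matrix close to a diagonal matrix with distinct entries is orthogonally
diagonalizable with eigenvalues close to these entries. -/
lemma eventually_exists_diagonalization {p : ℕ} {s : Fin p → ℝ} {δ : ℝ} (hδ : 0 < δ)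
    (hgap : ∀ a b, a < b → 2 * δ < s a - s b) :
    ∀ᶠ B in 𝓝 (diagonal s : Matrix (Fin p) (Fin p) ℝ), B.IsSymm →
      ∃ (W : Matrix (Fin p) (Fin p) ℝ) (t : Fin p → ℝ), StrictAnti t ∧
        (∀ a, |t a - s a| < δ) ∧ W * Wᵀ = 1 ∧ W * B * Wᵀ = diagonal t := by
  filter_upwards [eventually_all.2 (eventually_exists_eigenvector hδ hgap)] with B hB hsymm
  choose t ht w hw hBw using hB
  have hanti : StrictAnti t := fun a b hab => by
    have h1 := abs_lt.1 (ht a)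
    have h2 := abs_lt.1 (ht b)
    linarith [hgap a b hab]
  have hpos (a : Fin p) : 0 < w a ⬝ᵥ w a := by
    have h0 : 0 ≤ w a ⬝ᵥ w a := Finset.sum_nonneg fun i _ => mul_self_nonneg _
    exact h0.lt_of_ne fun h => hw a (dotProduct_self_eq_zero.1 h.symm)
  set v : Fin p → Fin p → ℝ := fun a => (√(w a ⬝ᵥ w a))⁻¹ • w a with hv
  have hvo : ∀ a b, v a ⬝ᵥ v b = if a = b then (1 : ℝ) else 0 := by
    intro a b
    simp only [hv, smul_dotProduct, dotProduct_smul, smul_eq_mul]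
    split_ifs with h
    · subst h
      have h1 := Real.mul_self_sqrt (hpos a).le
      have h2 : √(w a ⬝ᵥ w a) ≠ 0 := (Real.sqrt_pos.2 (hpos a)).ne'
      nth_rewrite 3 [← h1]
      field_simp
    · rw [dotProduct_eq_zero_of_eigenvectors hsymm (hBw a) (hBw b) (hanti.injective.ne h)]
      simp
  have hve : ∀ a, B *ᵥ v a = t a • v a := by
    intro a
    simp only [hv, mulVec_smul, hBw a]
    rw [smul_comm]
  exact ⟨of v, t, hanti, ht, conj_eq_diagonal_of_eigenvectors hvo hve⟩

/-- Entrywise eigenvalue equation comparing an orthogonal diagonalization of `B` with the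
coordinate axes. -/
lemma sub_mul_apply_of_diagonalization {p : ℕ} {B W : Matrix (Fin p) (Fin p) ℝ} {t : Fin p → ℝ}
    (hW : W * Wᵀ = 1) (hB : W * B * Wᵀ = diagonal t) (s : Fin p → ℝ) (b a : Fin p) :
    (t b - s a) * W b a = (W * (B - diagonal s)) b a := by
  have h : W * B = diagonal t * W := by
    rw [← hB, Matrix.mul_assoc, mul_eq_one_comm.1 hW, Matrix.mul_one]
  rw [Matrix.mul_sub, h, Matrix.sub_apply, diagonal_mul, mul_diagonal]
  ring

/-- The decreasingly ordered spectrum does not depend on the diagonalization. -/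
lemma diagonalization_eigenvalues_unique {p : ℕ} {A U V : Matrix (Fin p) (Fin p) ℝ}
    {s t : Fin p → ℝ} (hs : StrictAnti s) (ht : StrictAnti t)
    (hU : U * Uᵀ = 1) (hAs : U * A * Uᵀ = diagonal s)
    (hV : V * Vᵀ = 1) (hAt : V * A * Vᵀ = diagonal t) : t = s := by
  have hU' := mul_eq_one_comm.1 hU
  have hW : V * Uᵀ * (V * Uᵀ)ᵀ = 1 := by
    rw [transpose_mul, transpose_transpose, Matrix.mul_assoc, ← Matrix.mul_assoc Uᵀ, hU',
      Matrix.one_mul, hV]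
  have hWB : V * Uᵀ * diagonal s * (V * Uᵀ)ᵀ = diagonal t := by
    rw [← hAs, ← hAt, transpose_mul, transpose_transpose]
    calc V * Uᵀ * (U * A * Uᵀ) * (U * Vᵀ) = V * (Uᵀ * U) * A * (Uᵀ * U) * Vᵀ := by
          simp only [Matrix.mul_assoc]
      _ = V * A * Vᵀ := by rw [hU', Matrix.mul_one, Matrix.mul_one]
  have hsub : Set.range t ⊆ Set.range s := by
    rintro _ ⟨b, rfl⟩
    by_contra hb
    have h0 : ∀ a, (V * Uᵀ) b a = 0 := by
      intro a
      have h := sub_mul_apply_of_diagonalization hW hWB s b a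
      rw [sub_self, Matrix.mul_zero, Matrix.zero_apply] at h
      exact (mul_eq_zero.1 h).resolve_left
        (sub_ne_zero.2 fun h' => hb ⟨a, h'.symm⟩)
    have h1 := congrFun (congrFun hW b) b
    rw [mul_apply, one_apply_eq] at h1
    simp [h0] at h1
  have hrange : Set.range t = Set.range s := by
    refine Set.eq_of_subset_of_ncard_le hsub ?_ (Set.finite_range s)
    rw [← Set.image_univ, ← Set.image_univ, Set.ncard_image_of_injective _ hs.injective,
      Set.ncard_image_of_injective _ ht.injective]
  exact (StrictAnti.range_inj ht hs).1 hrange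

/-- The projection onto the first `k` eigenvectors depends on the matrix in a Lipschitz way near a
diagonal matrix with distinct entries. -/
lemma abs_conj_headProj_sub_le {p : ℕ} (k : ℕ) {B W : Matrix (Fin p) (Fin p) ℝ}
    {s t : Fin p → ℝ} {δ : ℝ} (hδ : 0 < δ) (hgap : ∀ a b, a < b → 2 * δ < s a - s b)
    (hst : ∀ a, |t a - s a| < δ) (hW : W * Wᵀ = 1) (hB : W * B * Wᵀ = diagonal t)
    (a b : Fin p) :
    |(Wᵀ * headProj p k * W - headProj p k) a b| ≤
      p * (δ⁻¹ * ∑ c, |(B - diagonal s) c a|) := by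
  have hW1 (c d : Fin p) : |W c d| ≤ 1 := by
    have h := congrFun (congrFun hW c) c
    rw [mul_apply, one_apply_eq] at h
    have h2 : W c d * W c d ≤ 1 := by
      rw [← h]
      exact Finset.single_le_sum (f := fun e => W c e * Wᵀ e c)
        (fun e _ => mul_self_nonneg (W c e)) (Finset.mem_univ d)
    exact abs_le_one_iff_mul_self_le_one.2 h2
  have hoff (c : Fin p) (hc : c ≠ a) : |W c a| ≤ δ⁻¹ * ∑ d, |(B - diagonal s) d a| := by
    have h := sub_mul_apply_of_diagonalization hW hB s c a
    have h1 : |(W * (B - diagonal s)) c a| ≤ ∑ d, |(B - diagonal s) d a| := by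
      rw [mul_apply]
      refine (Finset.abs_sum_le_sum_abs _ _).trans (Finset.sum_le_sum fun d _ => ?_)
      rw [abs_mul]
      exact mul_le_of_le_one_left (abs_nonneg _) (hW1 c d)
    have h2 : δ ≤ |t c - s a| := by
      have h3 := lt_abs_sub_of_gap hgap hc
      have h4 := abs_sub_abs_le_abs_sub (s c - s a) (s c - t c)
      have h5 := hst c
      rw [abs_sub_comm] at h5
      have h6 : s c - s a - (s c - t c) = t c - s a := by ring
      rw [h6] at h4
      linarith
    rw [← h, abs_mul] at h1
    rw [inv_mul_eq_div, le_div_iff₀' hδ]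
    exact (mul_le_mul_of_nonneg_right h2 (abs_nonneg _)).trans h1
  set J : Fin p → ℝ := fun a => if (a : ℕ) < k then 1 else 0 with hJ
  have hsum : (Wᵀ * headProj p k * W - headProj p k) a b
      = ∑ c, (J c - J a) * (W c a * W c b) := by
    have hW' : Wᵀ * W = 1 := mul_eq_one_comm.1 hW
    have h1 := congrFun (congrFun hW' a) b
    rw [mul_apply] at h1
    simp only [transpose_apply] at h1
    have h2 : headProj p k a b = J a * (1 : Matrix (Fin p) (Fin p) ℝ) a b := by
      simp only [headProj, diagonal_apply, one_apply, hJ]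
      split_ifs <;> simp
    rw [Matrix.sub_apply, h2, ← h1, Finset.mul_sum, mul_apply, ← Finset.sum_sub_distrib]
    refine Finset.sum_congr rfl fun c _ => ?_
    rw [headProj, mul_diagonal, transpose_apply]
    ring
  rw [hsum]
  refine (Finset.abs_sum_le_sum_abs _ _).trans ?_
  refine (Finset.sum_le_card_nsmul _ _ (δ⁻¹ * ∑ d, |(B - diagonal s) d a|) fun c _ => ?_).trans_eq
    (by simp)
  have hR : 0 ≤ δ⁻¹ * ∑ d, |(B - diagonal s) d a| :=
    mul_nonneg (by positivity) (Finset.sum_nonneg fun _ _ => abs_nonneg _)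
  by_cases hc : c = a
  · simpa [hc] using hR
  · have hJ1 : |J c - J a| ≤ 1 := by
      simp only [hJ]
      split_ifs <;> simp
    rw [abs_mul, abs_mul]
    calc |J c - J a| * (|W c a| * |W c b|) ≤ 1 * (|W c a| * 1) := by
          gcongr
          exact hW1 c b
      _ ≤ _ := by simpa using hoff c hc

/-- The sum of the first `k` rank-one projections in matrix form. -/
lemma sum_vecMulVec_eq {p : ℕ} (k : ℕ) (u : Fin p → Fin p → ℝ) :
    ∑ l ∈ Finset.univ.filter (fun l : Fin p => (l : ℕ) < k), vecMulVec (u l) (u l)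
      = (of u)ᵀ * headProj p k * of u := by
  ext a b
  rw [Matrix.sum_apply, mul_apply, Finset.sum_filter]
  refine Finset.sum_congr rfl fun c _ => ?_
  rw [headProj, mul_diagonal, vecMulVec_apply]
  split_ifs <;> simp

/-- `topProj` is computed by some orthogonal diagonalization with the given spectrum. -/
lemma exists_topProj_eq {p : ℕ} (k : ℕ) {A V : Matrix (Fin p) (Fin p) ℝ} {t : Fin p → ℝ}
    (ht : StrictAnti t) (hV : V * Vᵀ = 1) (hA : V * A * Vᵀ = diagonal t) :
    ∃ W : Matrix (Fin p) (Fin p) ℝ, W * Wᵀ = 1 ∧ W * A * Wᵀ = diagonal t ∧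
      topProj p k A = Wᵀ * headProj p k * W := by
  have hAV : A * Vᵀ = Vᵀ * diagonal t := by
    rw [← hA, ← Matrix.mul_assoc, ← Matrix.mul_assoc, mul_eq_one_comm.1 hV, Matrix.one_mul]
  have hex : ∃ P, IsTopProj p k A P := by
    refine ⟨_, fun a => V a, t, fun a b => ?_, ht, fun l => ?_, rfl⟩
    · have h := congrFun (congrFun hV a) b
      rw [one_apply] at h
      exact h
    · ext i
      have h := congrFun (congrFun hAV i) l
      rw [mul_diagonal, transpose_apply, mul_comm] at h
      exact h
  have hspec : IsTopProj p k A (topProj p k A) := by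
    rw [topProj, dif_pos hex]
    exact hex.choose_spec
  obtain ⟨u, s, hu, hs, hAu, hP⟩ := hspec
  obtain ⟨h1, h2⟩ := conj_eq_diagonal_of_eigenvectors hu hAu
  obtain rfl := diagonalization_eigenvalues_unique hs ht h1 h2 hV hA
  exact ⟨of u, h1, h2, hP.trans (sum_vecMulVec_eq k u)⟩

/-- The coefficients of the first order perturbation of the top spectral projection. -/
noncomputable def perturbCoeff {p : ℕ} (k : ℕ) (s : Fin p → ℝ) (a b : Fin p) : ℝ :=
  ((if (a : ℕ) < k then 1 else 0) - (if (b : ℕ) < k then 1 else 0)) / (s a - s b)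

/-- The first order variation of the top spectral projection in the direction `A'`. -/
noncomputable def topProjDeriv {p : ℕ} (k : ℕ) (s : Fin p → ℝ) (U A' : Matrix (Fin p) (Fin p) ℝ) :
    Matrix (Fin p) (Fin p) ℝ :=
  Uᵀ * of (fun a b => perturbCoeff k s a b * (U * A' * Uᵀ) a b) * U

/-- First order perturbation of the projection onto the first `k` coordinates, entrywise. -/
lemma hasDerivAt_of_commute_of_idempotent {p : ℕ} (k : ℕ) {s : Fin p → ℝ} (hs : StrictAnti s)
    {B M : ℝ → Matrix (Fin p) (Fin p) ℝ} {B' : Matrix (Fin p) (Fin p) ℝ}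
    (hB0 : B 0 = diagonal s) (hB : ∀ a b, HasDerivAt (fun ε => B ε a b) (B' a b) 0)
    (hM0 : M 0 = headProj p k)
    (hM : ∀ a b, (fun ε => (M ε - headProj p k) a b) =O[𝓝 0] fun ε => ε)
    (hcomm : ∀ᶠ ε in 𝓝 0, M ε * B ε = B ε * M ε) (hidem : ∀ᶠ ε in 𝓝 0, M ε * M ε = M ε)
    (a b : Fin p) :
    HasDerivAt (fun ε => M ε a b) (perturbCoeff k s a b * B' a b) 0 := by
  set J : Fin p → ℝ := fun a => if (a : ℕ) < k then 1 else 0 with hJ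
  have hBO (a b : Fin p) : (fun ε => (B ε - diagonal s) a b) =O[𝓝 0] fun ε => ε := by
    simpa [← hB0] using (hB a b).isBigO_sub
  have hmul {X Y : ℝ → Matrix (Fin p) (Fin p) ℝ} (hX : ∀ a b, (X · a b) =O[𝓝 0] fun ε : ℝ => ε)
      (hY : ∀ a b, (Y · a b) =O[𝓝 0] fun ε : ℝ => ε) (a b : Fin p) :
      (fun ε => (X ε * Y ε) a b) =o[𝓝 0] fun ε : ℝ => ε := by
    have h1 : (fun ε => (X ε * Y ε) a b) =O[𝓝 0] fun ε : ℝ => ε * ε := by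
      simp only [mul_apply]
      exact Asymptotics.IsBigO.fun_sum fun c _ => (hX a c).mul (hY c b)
    refine h1.trans_isLittleO ?_
    simpa [pow_two] using Asymptotics.isLittleO_pow_id (𝕜 := ℝ) (n := 2) one_lt_two
  set D : ℝ → Matrix (Fin p) (Fin p) ℝ := fun ε => M ε - headProj p k with hD
  set E : ℝ → Matrix (Fin p) (Fin p) ℝ := fun ε => B ε - diagonal s with hE
  have hMD (ε : ℝ) : M ε = headProj p k + D ε := by simp [hD]
  have hBE (ε : ℝ) : B ε = diagonal s + E ε := by simp [hE]
  suffices h : (fun ε => D ε a b - (J a - J b) / (s a - s b) * E ε a b) =o[𝓝 0] fun ε => ε by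
    rw [hasDerivAt_iff_isLittleO]
    have h2 := (hasDerivAt_iff_isLittleO.1 (hB a b)).const_mul_left ((J a - J b) / (s a - s b))
    simp only [sub_zero, smul_eq_mul, hM0, hB0] at h2 ⊢
    refine (h.add h2).congr_left fun ε => ?_
    simp only [hD, hE, Matrix.sub_apply, hJ, perturbCoeff]
    ring
  rcases eq_or_ne a b with rfl | hab
  · have h2 := (hmul hM hM a a).const_mul_left (1 - 2 * J a)
    refine h2.congr' ?_ EventuallyEq.rfl
    filter_upwards [hidem] with ε hε
    rw [hMD, Matrix.add_mul, Matrix.mul_add, Matrix.mul_add] at hε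
    have h3 := congrFun (congrFun hε a) a
    simp only [Matrix.add_apply, headProj, diagonal_mul, mul_diagonal, diagonal_apply_eq] at h3
    change (1 - 2 * J a) * (D ε * D ε) a a = _
    change J a * J a + J a * D ε a a + (D ε a a * J a + (D ε * D ε) a a) = J a + D ε a a at h3
    have h4 : J a = 0 ∨ J a = 1 := by
      simp only [hJ]
      split_ifs <;> simp
    rcases h4 with h4 | h4 <;> rw [h4] at h3 ⊢ <;> rw [sub_self, zero_div, zero_mul] <;> linarith
  · have hsab : s a - s b ≠ 0 := sub_ne_zero.2 (hs.injective.ne hab)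
    have h2 := ((hmul hM hBO a b).sub (hmul hBO hM a b)).const_mul_left (s a - s b)⁻¹
    refine h2.congr' ?_ EventuallyEq.rfl
    filter_upwards [hcomm] with ε hε
    rw [hMD, hBE, Matrix.add_mul, Matrix.mul_add, Matrix.mul_add, Matrix.add_mul, Matrix.mul_add,
      Matrix.mul_add] at hε
    have h3 := congrFun (congrFun hε a) b
    simp only [Matrix.add_apply, headProj, diagonal_mul, mul_diagonal,
      diagonal_apply_ne _ hab] at h3
    change (s a - s b)⁻¹ * ((D ε * E ε) a b - (E ε * D ε) a b) = _
    change 0 * s b + J a * E ε a b + (D ε a b * s b + (D ε * E ε) a b)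
      = 0 * J b + s a * D ε a b + (E ε a b * J b + (E ε * D ε) a b) at h3
    field_simp
    linarith

/-- At a symmetric matrix with distinct eigenvalues, `topProj` is given by the diagonalization,
and its derivative along a differentiable curve of symmetric matrices is obtained from first order
perturbation theory. -/
lemma topProj_eq_and_hasDerivAt {p : ℕ} (k : ℕ) {A : ℝ → Matrix (Fin p) (Fin p) ℝ}
    {A' U : Matrix (Fin p) (Fin p) ℝ} {s : Fin p → ℝ} (hs : StrictAnti s)
    (hsymm : ∀ ε, (A ε).IsSymm) (hA : ∀ a b, HasDerivAt (fun ε => A ε a b) (A' a b) 0)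
    (hU : U * Uᵀ = 1) (hUA : U * A 0 * Uᵀ = diagonal s) :
    topProj p k (A 0) = Uᵀ * headProj p k * U ∧
    ∀ a b, HasDerivAt (fun ε => topProj p k (A ε) a b)
      (topProjDeriv k s U A' a b) 0 := by
  have hU' : Uᵀ * U = 1 := mul_eq_one_comm.1 hU
  obtain ⟨δ, hδ, hgap⟩ := hs.exists_gap
  set B : ℝ → Matrix (Fin p) (Fin p) ℝ := fun ε => U * A ε * Uᵀ with hBdef
  set M : ℝ → Matrix (Fin p) (Fin p) ℝ := fun ε => U * topProj p k (A ε) * Uᵀ with hMdef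
  have hlin (X : ℝ → Matrix (Fin p) (Fin p) ℝ) (X' V W : Matrix (Fin p) (Fin p) ℝ)
      (hX : ∀ a b, HasDerivAt (fun ε => X ε a b) (X' a b) 0) (a b : Fin p) :
      HasDerivAt (fun ε => (V * X ε * W) a b) ((V * X' * W) a b) 0 := by
    simp only [mul_apply]
    exact HasDerivAt.fun_sum fun c _ => (HasDerivAt.fun_sum fun d _ =>
      (hX d c).const_mul (V a d)).mul_const (W c b)
  have hB : ∀ a b, HasDerivAt (fun ε => B ε a b) ((U * A' * Uᵀ) a b) 0 := hlin A A' U Uᵀ hA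
  have hcont : Tendsto B (𝓝 0) (𝓝 (diagonal s)) := by
    rw [← hUA]
    exact tendsto_pi_nhds.2 fun a => tendsto_pi_nhds.2 fun b => (hB a b).continuousAt.tendsto
  have hBsymm (ε : ℝ) : (B ε).IsSymm := by
    rw [Matrix.IsSymm, hBdef]
    simp only [transpose_mul, transpose_transpose, (hsymm ε).eq, Matrix.mul_assoc]
  have hkey : ∀ᶠ ε in 𝓝 0, ∃ (W : Matrix (Fin p) (Fin p) ℝ) (t : Fin p → ℝ),
      (∀ a, |t a - s a| < δ) ∧ W * Wᵀ = 1 ∧ W * B ε * Wᵀ = diagonal t ∧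
      M ε = Wᵀ * headProj p k * W := by
    filter_upwards [hcont.eventually (eventually_exists_diagonalization hδ hgap)] with ε hε
    obtain ⟨W, t, ht, hst, hW, hWB⟩ := hε (hBsymm ε)
    have h1 : W * U * (W * U)ᵀ = 1 := by
      rw [transpose_mul, Matrix.mul_assoc, ← Matrix.mul_assoc U, hU, Matrix.one_mul, hW]
    have h2 : W * U * A ε * (W * U)ᵀ = diagonal t := by
      rw [← hWB, transpose_mul]
      simp only [hBdef, Matrix.mul_assoc]
    obtain ⟨V, hV, hVA, hP⟩ := exists_topProj_eq k ht h1 h2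
    refine ⟨V * Uᵀ, t, hst, ?_, ?_, ?_⟩
    · rw [transpose_mul, transpose_transpose, Matrix.mul_assoc, ← Matrix.mul_assoc Uᵀ, hU',
        Matrix.one_mul, hV]
    · calc V * Uᵀ * B ε * (V * Uᵀ)ᵀ = V * (Uᵀ * U) * A ε * (Uᵀ * U) * Vᵀ := by
            simp only [hBdef, transpose_mul, transpose_transpose, Matrix.mul_assoc]
        _ = _ := by rw [hU', Matrix.mul_one, Matrix.mul_one, hVA]
    · simp only [hMdef, hP, transpose_mul, transpose_transpose, Matrix.mul_assoc]
  have hback (ε : ℝ) : topProj p k (A ε) = Uᵀ * M ε * U := by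
    calc topProj p k (A ε) = Uᵀ * U * topProj p k (A ε) * (Uᵀ * U) := by simp [hU']
      _ = _ := by simp only [hMdef, Matrix.mul_assoc]
  have hest : ∀ᶠ ε in 𝓝 0, ∀ a b, |(M ε - headProj p k) a b| ≤
      p * (δ⁻¹ * ∑ c, |(B ε - diagonal s) c a|) := by
    filter_upwards [hkey] with ε hε a b
    obtain ⟨W, t, hst, hW, hWB, hM⟩ := hε
    rw [hM]
    exact abs_conj_headProj_sub_le k hδ hgap hst hW hWB a b
  have hM0 : M 0 = headProj p k := by
    ext a b
    have h := hest.self_of_nhds a b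
    have h0 : B 0 = diagonal s := hUA
    simp only [h0, sub_self, abs_zero, Finset.sum_const_zero, mul_zero,
      Matrix.sub_apply] at h
    exact sub_eq_zero.1 (abs_nonpos_iff.1 h)
  have hMO (a b : Fin p) : (fun ε => (M ε - headProj p k) a b) =O[𝓝 0] fun ε => ε := by
    have hBO (c : Fin p) : (fun ε => |(B ε - diagonal s) c a|) =O[𝓝 0] fun ε => ε := by
      have h := (hB c a).isBigO_sub.norm_left
      have h0 : B 0 = diagonal s := hUA
      simpa [h0] using h
    refine Asymptotics.IsBigO.trans (.of_bound 1 ?_)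
      (((Asymptotics.IsBigO.fun_sum fun c (_ : c ∈ Finset.univ) => hBO c).const_mul_left
        δ⁻¹).const_mul_left p)
    filter_upwards [hest] with ε hε
    rw [one_mul]
    exact (hε a b).trans (le_abs_self _)
  have hcomm : ∀ᶠ ε in 𝓝 0, M ε * B ε = B ε * M ε := by
    filter_upwards [hkey] with ε ⟨W, t, hst, hW, hWB, hM⟩
    have hW' : Wᵀ * W = 1 := mul_eq_one_comm.1 hW
    have hBε : B ε = Wᵀ * diagonal t * W := by
      calc B ε = Wᵀ * W * B ε * (Wᵀ * W) := by simp [hW']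
        _ = _ := by rw [← hWB]; simp only [Matrix.mul_assoc]
    rw [hM, hBε]
    calc Wᵀ * headProj p k * W * (Wᵀ * diagonal t * W)
        = Wᵀ * (headProj p k * (W * Wᵀ) * diagonal t) * W := by simp only [Matrix.mul_assoc]
      _ = Wᵀ * (diagonal t * (W * Wᵀ) * headProj p k) * W := by
        rw [hW, Matrix.mul_one, Matrix.mul_one, headProj, diagonal_mul_diagonal,
          diagonal_mul_diagonal]
        simp only [mul_comm]
      _ = _ := by simp only [Matrix.mul_assoc]
  have hidem : ∀ᶠ ε in 𝓝 0, M ε * M ε = M ε := by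
    filter_upwards [hkey] with ε ⟨W, t, hst, hW, hWB, hM⟩
    rw [hM]
    calc Wᵀ * headProj p k * W * (Wᵀ * headProj p k * W)
        = Wᵀ * (headProj p k * (W * Wᵀ) * headProj p k) * W := by simp only [Matrix.mul_assoc]
      _ = _ := by
        rw [hW, Matrix.mul_one]
        congr 2
        rw [headProj, diagonal_mul_diagonal]
        simp
  refine ⟨by rw [hback, hM0], ?_⟩
  simp only [hback]
  exact hlin M _ Uᵀ U fun a b =>
    hasDerivAt_of_commute_of_idempotent k hs hUA hB hM0 hMO hcomm hidem a b

lemma sampleMean_perturb_apply (n p : ℕ) (x : Fin n → Fin p → ℝ) (i : Fin n) (j : Fin p) (ε : ℝ)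
    (c : Fin p) :
    sampleMean n p (perturb n p x i j ε) c
      = sampleMean n p x c + ε * ((n : ℝ)⁻¹ * (Pi.single j 1 : Fin p → ℝ) c) := by
  have h : ∑ l, perturb n p x i j ε l = ∑ l, x l + ε • (Pi.single j 1 : Fin p → ℝ) := by
    rw [perturb, Finset.sum_update_of_mem (Finset.mem_univ i),
      ← Finset.add_sum_erase _ x (Finset.mem_univ i), Finset.sdiff_singleton_eq_erase]
    abel
  rw [sampleMean, sampleMean, h]
  simp only [Pi.smul_apply, Pi.add_apply, smul_eq_mul]
  ring

lemma perturb_sub_sampleMean_apply (n p : ℕ) (x : Fin n → Fin p → ℝ) (i : Fin n) (j : Fin p)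
    (ε : ℝ) (l : Fin n) (c : Fin p) :
    (perturb n p x i j ε l - sampleMean n p (perturb n p x i j ε)) c
      = (x l - sampleMean n p x) c
        + ε * (((if l = i then 1 else 0) - (n : ℝ)⁻¹) * (Pi.single j 1 : Fin p → ℝ) c) := by
  rw [Pi.sub_apply, sampleMean_perturb_apply, Pi.sub_apply, perturb]
  by_cases h : l = i
  · subst h
    simp only [Function.update_self, Pi.add_apply, Pi.smul_apply, smul_eq_mul, if_true]
    ring
  · simp only [Function.update_of_ne h, h, if_false]
    ring

lemma perturb_zero (n p : ℕ) (x : Fin n → Fin p → ℝ) (i : Fin n) (j : Fin p) :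
    perturb n p x i j 0 = x := by
  simp [perturb]

lemma sum_sub_sampleMean_apply {n p : ℕ} (hn : n ≠ 0) (x : Fin n → Fin p → ℝ) (c : Fin p) :
    ∑ l, (x l - sampleMean n p x) c = 0 := by
  have h : (n : ℝ) ≠ 0 := Nat.cast_ne_zero.2 hn
  simp [sampleMean, Finset.sum_sub_distrib, Finset.sum_apply, h]

lemma sampleCov_apply (n p : ℕ) (x : Fin n → Fin p → ℝ) (a b : Fin p) :
    sampleCov n p x a b
      = (n : ℝ)⁻¹ * ∑ l, (x l - sampleMean n p x) a * (x l - sampleMean n p x) b := by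
  simp only [sampleCov, Matrix.smul_apply, Matrix.sum_apply, vecMulVec_apply, smul_eq_mul]

lemma sampleCov_isSymm (n p : ℕ) (x : Fin n → Fin p → ℝ) : (sampleCov n p x).IsSymm := by
  ext a b
  rw [transpose_apply, sampleCov_apply, sampleCov_apply]
  simp only [mul_comm]

lemma hasDerivAt_const_add_id_mul (c d : ℝ) : HasDerivAt (fun ε : ℝ => c + ε * d) d 0 := by
  simpa using ((hasDerivAt_id (0 : ℝ)).mul_const d).const_add c

/-- The first order variation of the covariance when a point with deviation `y` is moved along
the `j`-th axis. -/
noncomputable def covDeriv {p : ℕ} (n : ℕ) (y : Fin p → ℝ) (j : Fin p) : Matrix (Fin p) (Fin p) ℝ :=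
  (n : ℝ)⁻¹ • (vecMulVec (Pi.single j 1) y + vecMulVec y (Pi.single j 1))

lemma hasDerivAt_sampleCov_perturb {n p : ℕ} (hn : n ≠ 0) (x : Fin n → Fin p → ℝ) (i : Fin n)
    (j a b : Fin p) :
    HasDerivAt (fun ε => sampleCov n p (perturb n p x i j ε) a b)
      (covDeriv n (x i - sampleMean n p x) j a b) 0 := by
  simp only [sampleCov_apply, perturb_sub_sampleMean_apply]
  have h := (HasDerivAt.fun_sum fun l (_ : l ∈ Finset.univ) =>
    (hasDerivAt_const_add_id_mul ((x l - sampleMean n p x) a)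
        (((if l = i then 1 else 0) - (n : ℝ)⁻¹) * (Pi.single j 1 : Fin p → ℝ) a)).mul
      (hasDerivAt_const_add_id_mul ((x l - sampleMean n p x) b)
        (((if l = i then 1 else 0) - (n : ℝ)⁻¹) * (Pi.single j 1 : Fin p → ℝ) b))).const_mul
    (n : ℝ)⁻¹
  refine h.congr_deriv ?_
  have hsum (c : Fin p) : ∑ l, (x l - sampleMean n p x) c * ((if l = i then 1 else 0) - (n : ℝ)⁻¹)
      = (x i - sampleMean n p x) c := by
    simp only [mul_sub, Finset.sum_sub_distrib, ← Finset.sum_mul,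
      sum_sub_sampleMean_apply hn]
    simp
  simp only [covDeriv, Matrix.smul_apply, Matrix.add_apply, vecMulVec_apply, smul_eq_mul]
  rw [← hsum a, ← hsum b]
  congr 1
  rw [Finset.mul_sum, Finset.sum_mul, ← Finset.sum_add_distrib]
  refine Finset.sum_congr rfl fun l _ => ?_
  ring

lemma hasDerivAt_recon_perturb {n p : ℕ} (k : ℕ) (hn : n ≠ 0) (x : Fin n → Fin p → ℝ)
    {U : Matrix (Fin p) (Fin p) ℝ} {s : Fin p → ℝ} (hs : StrictAnti s) (hU : U * Uᵀ = 1)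
    (hUA : U * sampleCov n p x * Uᵀ = diagonal s) (i : Fin n) (j c : Fin p) :
    HasDerivAt (fun ε => recon n p k (perturb n p x i j ε) i c)
      ((n : ℝ)⁻¹ * (Pi.single j 1 : Fin p → ℝ) c
        + ((topProjDeriv k s U (covDeriv n (x i - sampleMean n p x) j) *ᵥ
            (x i - sampleMean n p x)) c
          + (1 - (n : ℝ)⁻¹) * (Uᵀ * headProj p k * U) c j)) 0 := by
  obtain ⟨hP0, hP⟩ := topProj_eq_and_hasDerivAt k
    (A := fun ε => sampleCov n p (perturb n p x i j ε))
    (A' := covDeriv n (x i - sampleMean n p x) j) hs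
    (fun ε => sampleCov_isSymm n p _) (hasDerivAt_sampleCov_perturb hn x i j) hU
    (by rw [perturb_zero]; exact hUA)
  simp only [recon, Pi.add_apply, mulVec, dotProduct, sampleMean_perturb_apply,
    perturb_sub_sampleMean_apply]
  refine ((hasDerivAt_const_add_id_mul _ _).add (HasDerivAt.fun_sum fun d _ =>
    (hP c d).mul (hasDerivAt_const_add_id_mul _ _))).congr_deriv ?_
  rw [hP0, Finset.sum_add_distrib]
  simp only [zero_mul, add_zero, if_true]
  congr 2
  rw [Finset.sum_eq_single j (fun d _ hd => by simp [hd]) (by simp), Pi.single_eq_same]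
  ring

lemma sum_topProjDeriv_covDeriv_mulVec {p : ℕ} (n k : ℕ) (s : Fin p → ℝ)
    {U : Matrix (Fin p) (Fin p) ℝ} (hU : U * Uᵀ = 1) (y : Fin p → ℝ) :
    ∑ j, (topProjDeriv k s U (covDeriv n y j) *ᵥ y) j
      = ∑ a, ∑ b, perturbCoeff k s a b * ((n : ℝ)⁻¹ * ((U *ᵥ y) b * (U *ᵥ y) b)) := by
  have hconj (j a b : Fin p) : (U * covDeriv n y j * Uᵀ) a b
      = (n : ℝ)⁻¹ * (U a j * (U *ᵥ y) b + (U *ᵥ y) a * U b j) := by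
    rw [covDeriv, Matrix.mul_smul, Matrix.smul_mul, Matrix.mul_add, Matrix.add_mul, mul_vecMulVec,
      mul_vecMulVec, vecMulVec_mul, vecMulVec_mul, vecMul_transpose, vecMul_transpose]
    simp [vecMulVec_apply]
  have hrow (a b : Fin p) : ∑ j, U a j * U b j = if a = b then 1 else 0 := by
    have h := congrFun (congrFun hU a) b
    rwa [mul_apply, one_apply] at h
  have hterm (j : Fin p) : (topProjDeriv k s U (covDeriv n y j) *ᵥ y) j
      = ∑ a, ∑ b, perturbCoeff k s a b * (n : ℝ)⁻¹ * (U *ᵥ y) b *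
        ((U a j * U a j) * (U *ᵥ y) b + (U a j * U b j) * (U *ᵥ y) a) := by
    rw [topProjDeriv, ← mulVec_mulVec, ← mulVec_mulVec]
    generalize U *ᵥ y = z at hconj ⊢
    simp only [mulVec, dotProduct, transpose_apply, of_apply, hconj, Finset.mul_sum]
    refine Finset.sum_congr rfl fun a _ => Finset.sum_congr rfl fun b _ => ?_
    ring
  simp only [hterm]
  rw [Finset.sum_comm]
  refine Finset.sum_congr rfl fun a _ => ?_
  rw [Finset.sum_comm]
  refine Finset.sum_congr rfl fun b _ => ?_
  rw [← Finset.mul_sum, Finset.sum_add_distrib, ← Finset.sum_mul, ← Finset.sum_mul, hrow, hrow,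
    if_pos rfl]
  by_cases hab : a = b
  · simp [hab, perturbCoeff]
  · rw [if_neg hab]
    ring

lemma sum_sq_mulVec_eq_eigenvalue {n p : ℕ} {x : Fin n → Fin p → ℝ}
    {U : Matrix (Fin p) (Fin p) ℝ} {s : Fin p → ℝ}
    (hUA : U * sampleCov n p x * Uᵀ = diagonal s) (b : Fin p) :
    ∑ i, (n : ℝ)⁻¹ * ((U *ᵥ (x i - sampleMean n p x)) b * (U *ᵥ (x i - sampleMean n p x)) b)
      = s b := by
  have h := congrFun (congrFun hUA b) b
  rw [diagonal_apply_eq, sampleCov, Matrix.mul_smul, Matrix.smul_mul, Matrix.mul_sum,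
    Matrix.sum_mul] at h
  simp only [mul_vecMulVec, vecMulVec_mul, vecMul_transpose, Matrix.smul_apply, Matrix.sum_apply,
    vecMulVec_apply, smul_eq_mul] at h
  rw [← h, Finset.mul_sum]

lemma sum_perturbCoeff_mul {p : ℕ} (k : ℕ) (s : Fin p → ℝ) :
    ∑ a, ∑ b, perturbCoeff k s a b * s b
      = ∑ a ∈ Finset.univ.filter (fun a : Fin p => (a : ℕ) < k),
          ∑ b ∈ Finset.univ.filter (fun b : Fin p => k ≤ (b : ℕ)), (s a + s b) / (s a - s b) := by
  set g : Fin p → Fin p → ℝ := fun a b => if (a : ℕ) < k then if k ≤ (b : ℕ) then 1 else 0 else 0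
    with hg
  have h1 (a b : Fin p) : perturbCoeff k s a b * s b
      = g a b * (s b / (s a - s b)) + g b a * (s b / (s b - s a)) := by
    rw [← neg_sub (s a) (s b), div_neg]
    simp only [perturbCoeff, hg, ← not_lt]
    split_ifs <;> ring
  have h2 : ∑ a, ∑ b, g b a * (s b / (s b - s a)) = ∑ a, ∑ b, g a b * (s a / (s a - s b)) :=
    Finset.sum_comm
  simp only [h1, Finset.sum_add_distrib]
  rw [h2, ← Finset.sum_add_distrib, Finset.sum_filter]
  refine Finset.sum_congr rfl fun a _ => ?_
  rw [← Finset.sum_add_distrib, Finset.sum_filter]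
  split_ifs with ha
  · refine Finset.sum_congr rfl fun b _ => ?_
    simp only [hg, ha, if_true]
    split_ifs <;> ring
  · simp [hg, ha]

lemma trace_conj_headProj {p k : ℕ} (hkp : k ≤ p) {U : Matrix (Fin p) (Fin p) ℝ}
    (hU : U * Uᵀ = 1) : ∑ j, (Uᵀ * headProj p k * U) j j = k := by
  change (Uᵀ * headProj p k * U).trace = k
  rw [trace_mul_comm, ← Matrix.mul_assoc, hU, Matrix.one_mul, headProj, trace_diagonal,
    Finset.sum_boole, Fin.card_filter_val_lt, min_eq_right hkp]

/-- For a fixed sample `x 0, …, x (n-1) ∈ ℝ^p` at which the sample covariance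
matrix has distinct eigenvalues `s 0 > ⋯ > s (p-1)`, the empirically centered PCA
reconstructions are differentiable functions of the data entries and
`∑ᵢ ∑ⱼ ∂x̂ᵢⱼ/∂xᵢⱼ = (n−1)k + p + ∑_{j ≤ k} ∑_{ℓ > k} (s_j + s_ℓ)/(s_j − s_ℓ)`,
the partial derivative being the derivative at `ε = 0` along the perturbation `xᵢ ↦ xᵢ + ε eⱼ`. -/
theorem stmt_2 (n p k : ℕ) (hn : 2 ≤ n) (hp : 2 ≤ p) (hk1 : 1 ≤ k) (hkp : k < p)
    (x : Fin n → Fin p → ℝ)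
    (u : Fin p → Fin p → ℝ) (s : Fin p → ℝ)
    (hortho : ∀ a b, u a ⬝ᵥ u b = if a = b then (1 : ℝ) else 0)
    (hanti : StrictAnti s)
    (heig : ∀ ℓ, (sampleCov n p x).mulVec (u ℓ) = s ℓ • u ℓ) :
    (∀ (i : Fin n) (j : Fin p),
        DifferentiableAt ℝ (fun ε : ℝ => recon n p k (perturb n p x i j ε) i) 0)
    ∧ ∑ i : Fin n, ∑ j : Fin p,
          deriv (fun ε : ℝ => recon n p k (perturb n p x i j ε) i j) 0
        = ((n : ℝ) - 1) * k + p
          + ∑ a ∈ Finset.univ.filter (fun a : Fin p => (a : ℕ) < k),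
              ∑ b ∈ Finset.univ.filter (fun b : Fin p => k ≤ (b : ℕ)),
                (s a + s b) / (s a - s b) := by
  obtain ⟨hU, hUA⟩ := conj_eq_diagonal_of_eigenvectors hortho heig
  have hn0 : n ≠ 0 := by omega
  have hderiv := hasDerivAt_recon_perturb k hn0 x hanti hU hUA
  refine ⟨fun i j => differentiableAt_pi.2 fun c => (hderiv i j c).differentiableAt, ?_⟩
  have hnR : (n : ℝ) ≠ 0 := Nat.cast_ne_zero.2 hn0
  have hrow (i : Fin n) :
      ∑ j, deriv (fun ε : ℝ => recon n p k (perturb n p x i j ε) i j) 0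
        = (n : ℝ)⁻¹ * p + ((∑ a, ∑ b, perturbCoeff k s a b * ((n : ℝ)⁻¹ *
            ((of u *ᵥ (x i - sampleMean n p x)) b * (of u *ᵥ (x i - sampleMean n p x)) b)))
          + (1 - (n : ℝ)⁻¹) * k) := by
    simp only [(hderiv i _ _).deriv, Finset.sum_add_distrib, ← Finset.mul_sum,
      sum_topProjDeriv_covDeriv_mulVec n k s hU, trace_conj_headProj hkp.le hU,
      Pi.single_eq_same]
    simp
  simp only [hrow, Finset.sum_add_distrib, Finset.sum_const, Finset.card_univ, Fintype.card_fin,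
    nsmul_eq_mul]
  have hcomm : ∑ i, ∑ a, ∑ b, perturbCoeff k s a b * ((n : ℝ)⁻¹ *
      ((of u *ᵥ (x i - sampleMean n p x)) b * (of u *ᵥ (x i - sampleMean n p x)) b))
      = ∑ a, ∑ b, perturbCoeff k s a b * s b := by
    rw [Finset.sum_comm]
    refine Finset.sum_congr rfl fun a _ => ?_
    rw [Finset.sum_comm]
    refine Finset.sum_congr rfl fun b _ => ?_
    rw [← Finset.mul_sum, sum_sq_mulVec_eq_eigenvalue hUA]
  rw [hcomm, sum_perturbCoeff_mul]
  field_simp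
  ring
end

section
/- Suppose the points x_1,…,x_n are not all contained in a single line in ℝ^p and that the spatial median t(F_n) satisfies t(F_n) ≠ x_ℓ for all ℓ = 1,…,n. Then for every i, j, the spatial sign covariance matrix of the perturbed sample satisfies (1/ε){S(F_{n,i,j,ε}) − S(F_n)} → H_{ij} as ε → 0, where H_{ij} = (1/n) A_i e_j (y_i'/‖y_i‖) + (1/n) (y_i/‖y_i‖) e_j' A_i − (1/n) Σ_{ℓ=1}^n A_ℓ G^{-1} A_i e_j (y_ℓ'/‖y_ℓ‖) − (1/n) Σ_{ℓ=1}^n (y_ℓ/‖y_ℓ‖) e_j' A_i G^{-1} A_ℓ, with y_ℓ := x_ℓ − t(F_n), A_ℓ := ‖y_ℓ‖^{-1} (I_p − y_ℓ y_ℓ'/‖y_ℓ‖²), and G := Σ_{ℓ=1}^n A_ℓ. -/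
open Matrix Filter

/-- The perturbed sample `F_{n,i,j,ε}`, in which `x i` is replaced by `x i + ε • e j`. -/
noncomputable def eperturb (n p : ℕ) (x : Fin n → EuclideanSpace ℝ (Fin p))
    (i : Fin n) (j : Fin p) (ε : ℝ) : Fin n → EuclideanSpace ℝ (Fin p) :=
  Function.update x i (x i + ε • EuclideanSpace.single j (1 : ℝ))

/-- The spatial sign `u(v) = v/‖v‖` (with `u(0) = 0`, since `‖0‖⁻¹ = 0` in Lean),
as a plain vector in `Fin p → ℝ`. -/
noncomputable def sgn {p : ℕ} (v : EuclideanSpace ℝ (Fin p)) : Fin p → ℝ :=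
  fun r => ‖v‖⁻¹ * v r

/-- The spatial sign covariance matrix `(1/n) ∑ ℓ u(z ℓ − t) u(z ℓ − t)'` of the sample `z`
with respect to the location `t` (in applications, `t` is the spatial median of `z`). -/
noncomputable def sscm (n p : ℕ) (z : Fin n → EuclideanSpace ℝ (Fin p))
    (t : EuclideanSpace ℝ (Fin p)) : Matrix (Fin p) (Fin p) ℝ :=
  (n : ℝ)⁻¹ • ∑ ℓ, Matrix.vecMulVec (sgn (z ℓ - t)) (sgn (z ℓ - t))

open scoped RealInnerProductSpace Topology

section SpatialMedian

variable {E : Type*} [NormedAddCommGroup E] [InnerProductSpace ℝ E]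

/-- The derivative at `y ≠ 0` of the normalization map `v ↦ ‖v‖⁻¹ • v`. -/
noncomputable def normalizeDeriv (y : E) : E →L[ℝ] E :=
  ‖y‖⁻¹ • (ContinuousLinearMap.id ℝ E - (‖y‖ ^ 2)⁻¹ • (innerSL ℝ y).smulRight y)

lemma normalizeDeriv_apply (y v : E) :
    normalizeDeriv y v = ‖y‖⁻¹ • (v - ((‖y‖ ^ 2)⁻¹ * ⟪y, v⟫) • y) := by
  simp [normalizeDeriv, smul_smul]

lemma hasStrictFDerivAt_norm_of_ne_zero {y : E} (hy : y ≠ 0) :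
    HasStrictFDerivAt (fun v : E => ‖v‖) (‖y‖⁻¹ • innerSL ℝ y) y := by
  have h := (hasStrictFDerivAt_norm_sq y).sqrt (by simpa using hy)
  simp only [Real.sqrt_sq (norm_nonneg _)] at h
  convert h using 1
  ext v
  simp
  ring

lemma hasStrictFDerivAt_normalize {y : E} (hy : y ≠ 0) :
    HasStrictFDerivAt (fun v : E => ‖v‖⁻¹ • v) (normalizeDeriv y) y := by
  have hn : ‖y‖ ≠ 0 := norm_ne_zero_iff.mpr hy
  have h := ((hasStrictDerivAt_inv hn).comp_hasStrictFDerivAt y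
    (hasStrictFDerivAt_norm_of_ne_zero hy)).smul (hasStrictFDerivAt_id y)
  refine h.congr_fderiv ?_
  ext v
  simp only [normalizeDeriv_apply, _root_.add_apply, _root_.smul_apply,
    ContinuousLinearMap.smulRight_apply, innerSL_apply_apply, Function.comp_apply,
    ContinuousLinearMap.id_apply, id_eq, smul_eq_mul]
  module

lemma inner_normalizeDeriv_nonneg (y v : E) : 0 ≤ ⟪v, normalizeDeriv y v⟫ := by
  rcases eq_or_ne y 0 with rfl | hy
  · simp [normalizeDeriv_apply]
  have hn : 0 < ‖y‖ := norm_pos_iff.mpr hy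
  have h := real_inner_mul_inner_self_le y v
  rw [normalizeDeriv_apply, inner_smul_right, inner_sub_right, inner_smul_right,
    real_inner_comm y v, real_inner_self_eq_norm_sq]
  rw [real_inner_self_eq_norm_sq, real_inner_self_eq_norm_sq] at h
  refine mul_nonneg (by positivity) (sub_nonneg.mpr ?_)
  rw [mul_assoc, inv_mul_le_iff₀ (by positivity)]
  exact h

lemma exists_smul_eq_of_inner_normalizeDeriv_eq_zero {y v : E} (hy : y ≠ 0) (hv : v ≠ 0)
    (h : ⟪v, normalizeDeriv y v⟫ = 0) : ∃ c : ℝ, y = c • v := by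
  have hn : ‖y‖ ≠ 0 := norm_ne_zero_iff.mpr hy
  have hsq : ‖v‖ ^ 2 * ‖y‖ ^ 2 = ⟪v, y⟫ ^ 2 := by
    rw [normalizeDeriv_apply, inner_smul_right, inner_sub_right, inner_smul_right,
      real_inner_comm v y, real_inner_self_eq_norm_sq] at h
    field_simp at h
    linarith
  have habs : ‖⟪v, y⟫‖ = ‖v‖ * ‖y‖ := by
    rw [← sq_eq_sq₀ (norm_nonneg _) (by positivity), mul_pow, hsq, Real.norm_eq_abs, sq_abs]
  have hspan : v = 0 ∨ ∃ c : ℝ, y = c • v := ((norm_inner_eq_norm_tfae ℝ v y).out 0 2).mp habs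
  exact hspan.resolve_left hv

variable {ι : Type*} [Fintype ι]

/-- If no line contains all the points, the sum of the derivatives of the normalization maps,
which is the Hessian of the sum of distances, is injective. -/
lemma sum_normalizeDeriv_injective {x : ι → E} {t₀ : E}
    (hline : ¬ ∃ a v : E, ∀ ℓ, ∃ c : ℝ, x ℓ = a + c • v) (hne : ∀ ℓ, x ℓ - t₀ ≠ 0) :
    Function.Injective (∑ ℓ, normalizeDeriv (x ℓ - t₀) : E →L[ℝ] E) := by
  rw [injective_iff_map_eq_zero]
  intro v hv
  by_contra hv0
  have hsum : ∑ ℓ, ⟪v, normalizeDeriv (x ℓ - t₀) v⟫ = 0 := by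
    rw [← inner_sum, ← _root_.sum_apply, hv, inner_zero_right]
  rw [Finset.sum_eq_zero_iff_of_nonneg fun ℓ _ => inner_normalizeDeriv_nonneg _ _] at hsum
  refine hline ⟨t₀, v, fun ℓ => ?_⟩
  obtain ⟨c, hc⟩ := exists_smul_eq_of_inner_normalizeDeriv_eq_zero (hne ℓ) hv0
    (hsum ℓ (Finset.mem_univ ℓ))
  exact ⟨c, by rw [← hc, add_sub_cancel]⟩

/-- If no line contains all the points, the spatial median is unique. -/
lemma sum_dist_lt_of_ne_spatialMedian {x : ι → E} {t₀ : E}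
    (hline : ¬ ∃ a v : E, ∀ ℓ, ∃ c : ℝ, x ℓ = a + c • v)
    (ht₀ : ∀ t, ∑ ℓ, ‖x ℓ - t₀‖ ≤ ∑ ℓ, ‖x ℓ - t‖) {t : E} (ht : t ≠ t₀) :
    ∑ ℓ, ‖x ℓ - t₀‖ < ∑ ℓ, ‖x ℓ - t‖ := by
  have hsame : ∃ ℓ, ¬ SameRay ℝ (x ℓ - t₀) (x ℓ - t) := by
    by_contra! hall
    refine hline ⟨t₀, t - t₀, fun ℓ => ?_⟩
    rcases hall ℓ with h | h | ⟨a, b, ha, hb, hab⟩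
    · exact ⟨0, by rw [zero_smul, add_zero, sub_eq_zero.mp h]⟩
    · exact ⟨1, by rw [one_smul, add_sub_cancel, sub_eq_zero.mp h]⟩
    · have hcomb : (a - b) • (x ℓ - t₀) = -b • (t - t₀) := by
        have h' : b • (x ℓ - t) = b • (x ℓ - t₀) - b • (t - t₀) := by
          rw [← smul_sub, sub_sub_sub_cancel_right]
        rw [sub_smul, hab, h', neg_smul, sub_sub_cancel_left]
      have hne : a - b ≠ 0 := by
        intro h0
        rw [h0, zero_smul, eq_comm, smul_eq_zero, neg_eq_zero, sub_eq_zero] at hcomb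
        exact hcomb.elim hb.ne' ht
      refine ⟨(a - b)⁻¹ * -b, ?_⟩
      rw [mul_smul, ← hcomb, inv_smul_smul₀ hne, add_sub_cancel]
  obtain ⟨k, hk⟩ := hsame
  have hmid : ∀ ℓ, ‖x ℓ - (2⁻¹ : ℝ) • (t₀ + t)‖ = 2⁻¹ * ‖(x ℓ - t₀) + (x ℓ - t)‖ := fun ℓ => by
    rw [← abs_of_pos (show (0 : ℝ) < 2⁻¹ by norm_num), ← Real.norm_eq_abs, ← norm_smul]
    congr 1
    norm_num
    module
  have hlt : ∑ ℓ, ‖(x ℓ - t₀) + (x ℓ - t)‖ < ∑ ℓ, (‖x ℓ - t₀‖ + ‖x ℓ - t‖) :=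
    Finset.sum_lt_sum (fun ℓ _ => norm_add_le _ _)
      ⟨k, Finset.mem_univ k, norm_add_lt_of_not_sameRay hk⟩
  have h := ht₀ ((2⁻¹ : ℝ) • (t₀ + t))
  simp only [hmid, ← Finset.mul_sum] at h
  rw [Finset.sum_add_distrib] at hlt
  linarith

/-- Spatial medians of samples converging to a sample with a unique spatial median converge
to it. -/
lemma tendsto_spatialMedian [FiniteDimensional ℝ E] {α : Type*} {l : Filter α} {x : ι → E} {t₀ : E}
    (hx : ∀ t, t ≠ t₀ → ∑ ℓ, ‖x ℓ - t₀‖ < ∑ ℓ, ‖x ℓ - t‖) {z : α → ι → E} {tm : α → E}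
    (hz : ∀ ℓ, Tendsto (fun a => z a ℓ) l (𝓝 (x ℓ)))
    (htm : ∀ a t, ∑ ℓ, ‖z a ℓ - tm a‖ ≤ ∑ ℓ, ‖z a ℓ - t‖) : Tendsto tm l (𝓝 t₀) := by
  rw [Metric.tendsto_nhds]
  intro r hr
  obtain ⟨m, hm, hms⟩ := (isCompact_sphere t₀ r).exists_forall_le'
    (f := fun t => ∑ ℓ, ‖x ℓ - t‖) (by fun_prop)
    (fun t ht => hx t (by rintro rfl; simp at ht; exact hr.ne ht))
  have hS : Tendsto (fun a => ∑ ℓ, ‖z a ℓ - x ℓ‖) l (𝓝 0) := by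
    have h : ∀ ℓ, Tendsto (fun a => ‖z a ℓ - x ℓ‖) l (𝓝 0) := fun ℓ =>
      tendsto_iff_norm_sub_tendsto_zero.mp (hz ℓ)
    simpa using tendsto_finsetSum Finset.univ fun ℓ _ => h ℓ
  filter_upwards [hS.eventually_lt_const
    (show (0 : ℝ) < (m - ∑ ℓ, ‖x ℓ - t₀‖) / 2 by linarith)] with a ha
  by_contra! hfar
  have h1 : ∑ ℓ, ‖x ℓ - tm a‖ ≤ ∑ ℓ, ‖z a ℓ - x ℓ‖ + ∑ ℓ, ‖z a ℓ - tm a‖ := by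
    rw [← Finset.sum_add_distrib]
    gcongr with ℓ
    rw [norm_sub_rev (z a ℓ) (x ℓ)]
    exact norm_sub_le_norm_sub_add_norm_sub _ _ _
  have h2 : ∑ ℓ, ‖z a ℓ - t₀‖ ≤ ∑ ℓ, ‖z a ℓ - x ℓ‖ + ∑ ℓ, ‖x ℓ - t₀‖ := by
    rw [← Finset.sum_add_distrib]
    gcongr with ℓ
    exact norm_sub_le_norm_sub_add_norm_sub _ _ _
  have h3 := htm a t₀
  have hd : 0 < dist (tm a) t₀ := hr.trans_le hfar
  set c := r / dist (tm a) t₀ with hc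
  have hc0 : 0 < c := by positivity
  have hc1 : c ≤ 1 := (div_le_one hd).mpr hfar
  have hsph : t₀ + c • (tm a - t₀) ∈ Metric.sphere t₀ r := by
    rw [mem_sphere_iff_norm, add_sub_cancel_left, norm_smul, Real.norm_of_nonneg hc0.le,
      ← dist_eq_norm, hc, div_mul_cancel₀ _ hd.ne']
  have hconv : ∑ ℓ, ‖x ℓ - (t₀ + c • (tm a - t₀))‖
      ≤ (1 - c) * ∑ ℓ, ‖x ℓ - t₀‖ + c * ∑ ℓ, ‖x ℓ - tm a‖ := by
    rw [Finset.mul_sum, Finset.mul_sum, ← Finset.sum_add_distrib]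
    gcongr with ℓ
    calc ‖x ℓ - (t₀ + c • (tm a - t₀))‖
        = ‖(1 - c) • (x ℓ - t₀) + c • (x ℓ - tm a)‖ := by congr 1; module
      _ ≤ _ := by
        refine (norm_add_le _ _).trans_eq ?_
        rw [norm_smul, norm_smul, Real.norm_of_nonneg hc0.le,
          Real.norm_of_nonneg (sub_nonneg.mpr hc1)]
  have h4 := hms _ hsph
  nlinarith

/-- The estimating equation of the spatial median. -/
lemma sum_normalize_eq_zero {z : ι → E} {t : E} (hne : ∀ ℓ, z ℓ - t ≠ 0)
    (ht : ∀ s, ∑ ℓ, ‖z ℓ - t‖ ≤ ∑ ℓ, ‖z ℓ - s‖) : ∑ ℓ, ‖z ℓ - t‖⁻¹ • (z ℓ - t) = 0 := by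
  have hd : HasFDerivAt (fun s => ∑ ℓ, ‖z ℓ - s‖)
      (∑ ℓ, (‖z ℓ - t‖⁻¹ • innerSL ℝ (z ℓ - t)) ∘L (-ContinuousLinearMap.id ℝ E)) t :=
    HasFDerivAt.fun_sum fun ℓ _ => (hasStrictFDerivAt_norm_of_ne_zero (hne ℓ)).hasFDerivAt.comp t
      ((hasFDerivAt_id t).const_sub (z ℓ))
  have h0 := IsLocalMin.hasFDerivAt_eq_zero (Eventually.of_forall ht) hd
  refine ext_inner_right ℝ fun v => ?_
  have hv := congrArg (fun L : E →L[ℝ] ℝ => L v) h0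
  simpa [sum_inner, inner_smul_left, ← inner_sub_left] using hv

/-- The derivative of the spatial median along a linear perturbation of the sample. -/
lemma exists_hasDerivAt_spatialMedian [FiniteDimensional ℝ E] {x w : ι → E} {t₀ : E}
    (hline : ¬ ∃ a v : E, ∀ ℓ, ∃ c : ℝ, x ℓ = a + c • v)
    (ht₀ : ∀ t, ∑ ℓ, ‖x ℓ - t₀‖ ≤ ∑ ℓ, ‖x ℓ - t‖) (hne : ∀ ℓ, x ℓ - t₀ ≠ 0) {tm : ℝ → E}
    (htm : ∀ ε t, ∑ ℓ, ‖x ℓ + ε • w ℓ - tm ε‖ ≤ ∑ ℓ, ‖x ℓ + ε • w ℓ - t‖) :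
    tm 0 = t₀ ∧ ∃ d, HasDerivAt tm d 0 ∧
      ∑ ℓ, normalizeDeriv (x ℓ - t₀) d = ∑ ℓ, normalizeDeriv (x ℓ - t₀) (w ℓ) := by
  have hlt : ∀ t, t ≠ t₀ → ∑ ℓ, ‖x ℓ - t₀‖ < ∑ ℓ, ‖x ℓ - t‖ := fun t ht =>
    sum_dist_lt_of_ne_spatialMedian hline ht₀ ht
  have htm0 : tm 0 = t₀ := by
    by_contra h
    have h0 := htm 0 t₀
    simp only [zero_smul, add_zero] at h0
    exact (hlt _ h).not_ge h0
  refine ⟨htm0, ?_⟩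
  have hz : ∀ ℓ, Tendsto (fun ε : ℝ => x ℓ + ε • w ℓ) (𝓝 0) (𝓝 (x ℓ)) := fun ℓ => by
    have h : Continuous fun ε : ℝ => x ℓ + ε • w ℓ := by fun_prop
    simpa using h.tendsto 0
  have htend : Tendsto tm (𝓝 0) (𝓝 t₀) := tendsto_spatialMedian hlt hz htm
  let Φ : ℝ × E → E := fun q => ∑ ℓ, ‖x ℓ + q.1 • w ℓ - q.2‖⁻¹ • (x ℓ + q.1 • w ℓ - q.2)
  have hΦ0 : Φ (0, t₀) = 0 := by simpa [Φ] using sum_normalize_eq_zero hne ht₀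
  have hzero : ∀ᶠ ε in 𝓝 0, Φ (ε, tm ε) = 0 := by
    have h : ∀ᶠ ε in 𝓝 0, ∀ ℓ, x ℓ + ε • w ℓ - tm ε ≠ 0 :=
      eventually_all.mpr fun ℓ => ((hz ℓ).sub htend).eventually_ne (hne ℓ)
    filter_upwards [h] with ε hε using sum_normalize_eq_zero hε (htm ε)
  let Λ : ι → ℝ × E →L[ℝ] E := fun ℓ =>
    (ContinuousLinearMap.fst ℝ ℝ E).smulRight (w ℓ) - ContinuousLinearMap.snd ℝ ℝ E
  have hΦ : HasStrictFDerivAt Φ (∑ ℓ, normalizeDeriv (x ℓ - t₀) ∘L Λ ℓ) (0, t₀) := by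
    refine HasStrictFDerivAt.fun_sum fun ℓ _ => ?_
    have h1 : HasStrictFDerivAt (fun q : ℝ × E => x ℓ + q.1 • w ℓ - q.2) (Λ ℓ) (0, t₀) :=
      (((hasStrictFDerivAt_fst (𝕜 := ℝ)).smul_const (w ℓ)).const_add (x ℓ)).sub
        hasStrictFDerivAt_snd
    have h2 : HasStrictFDerivAt (fun v : E => ‖v‖⁻¹ • v) (normalizeDeriv (x ℓ - t₀))
        (x ℓ + (0 : ℝ) • w ℓ - t₀) := by
      simpa using hasStrictFDerivAt_normalize (hne ℓ)
    exact h2.comp (0, t₀) h1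
  have hinv : ((∑ ℓ, normalizeDeriv (x ℓ - t₀) ∘L Λ ℓ) ∘L .inr ℝ ℝ E).IsInvertible := by
    have hinj := sum_normalizeDeriv_injective hline hne
    refine ⟨(LinearEquiv.ofInjectiveEndo (-(∑ ℓ, normalizeDeriv (x ℓ - t₀)) : E →L[ℝ] E).toLinearMap
      ?_).toContinuousLinearEquiv, ?_⟩
    · exact fun a b hab => hinj (neg_injective (by simpa using hab))
    · ext v
      simp [Λ]
  have hψ := hΦ.hasStrictFDerivAt_implicitFunctionOfProdDomain hinv
  have heq : hΦ.implicitFunctionOfProdDomain hinv =ᶠ[𝓝 0] tm := by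
    have hpair : Tendsto (fun ε : ℝ => (ε, tm ε)) (𝓝 0) (𝓝 ((0 : ℝ), t₀)) :=
      tendsto_id.prodMk_nhds htend
    filter_upwards [hpair.eventually
      (hΦ.eventually_apply_eq_iff_implicitFunctionOfProdDomain hinv), hzero] with ε h1 h2
    exact h1.mp (h2.trans hΦ0.symm)
  have hd := (hψ.hasFDerivAt.congr_of_eventuallyEq heq.symm).hasDerivAt
  refine ⟨_, hd, ?_⟩
  set d := (-((∑ ℓ, normalizeDeriv (x ℓ - t₀) ∘L Λ ℓ) ∘L .inr ℝ ℝ E).inverse ∘L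
    ((∑ ℓ, normalizeDeriv (x ℓ - t₀) ∘L Λ ℓ) ∘L .inl ℝ ℝ E)) 1
  have hcurve : HasDerivAt (fun ε : ℝ => Φ (ε, tm ε))
      ((∑ ℓ, normalizeDeriv (x ℓ - t₀) ∘L Λ ℓ) (1, d)) 0 := by
    have h : HasFDerivAt Φ (∑ ℓ, normalizeDeriv (x ℓ - t₀) ∘L Λ ℓ) (0, tm 0) := by
      rw [htm0]; exact hΦ.hasFDerivAt
    exact h.comp_hasDerivAt (0 : ℝ) ((hasDerivAt_id (0 : ℝ)).prodMk hd)
  have huniq := hcurve.unique ((hasDerivAt_const (0 : ℝ) (0 : E)).congr_of_eventuallyEq hzero)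
  simp only [_root_.sum_apply, ContinuousLinearMap.comp_apply, Λ,
    _root_.sub_apply, ContinuousLinearMap.smulRight_apply,
    ContinuousLinearMap.coe_fst', ContinuousLinearMap.coe_snd', one_smul, map_sub,
    Finset.sum_sub_distrib] at huniq
  exact (sub_eq_zero.mp huniq).symm

end SpatialMedian

lemma eperturb_apply {n p : ℕ} (x : Fin n → EuclideanSpace ℝ (Fin p)) (i : Fin n) (j : Fin p)
    (ε : ℝ) (ℓ : Fin n) :
    eperturb n p x i j ε ℓ = x ℓ + ε • (Pi.single i (EuclideanSpace.single j (1 : ℝ)) :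
      Fin n → EuclideanSpace ℝ (Fin p)) ℓ := by
  rcases eq_or_ne ℓ i with rfl | h
  · simp [eperturb]
  · simp [eperturb, h]

lemma mulVec_eq_normalizeDeriv {p : ℕ} (y v : EuclideanSpace ℝ (Fin p)) :
    (‖y‖⁻¹ • ((1 : Matrix (Fin p) (Fin p) ℝ)
      - (‖y‖ ^ 2)⁻¹ • Matrix.vecMulVec (fun r => y r) (fun r => y r))) *ᵥ v.ofLp
      = (normalizeDeriv y v).ofLp := by
  rw [normalizeDeriv_apply, smul_mulVec, sub_mulVec, one_mulVec, smul_mulVec, vecMulVec_mulVec]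
  ext r
  simp only [Pi.smul_apply, Pi.sub_apply, PiLp.smul_apply, PiLp.sub_apply, smul_eq_mul,
    MulOpposite.smul_eq_mul_unop, MulOpposite.unop_op, PiLp.inner_apply, dotProduct,
    RCLike.inner_apply, conj_trivial]
  simp only [mul_comm (v.ofLp _)]
  ring

/-- Suppose `x 0, …, x (n-1)` are not all contained in a single line in `ℝ^p`
and the spatial median `t₀ = t(F_n)` satisfies `t₀ ≠ x ℓ` for all `ℓ`.  Then for every `i, j`
the spatial sign covariance matrix of the perturbed sample (computed at its spatial median
`tm ε`) satisfies `(1/ε){S(F_{n,i,j,ε}) − S(F_n)} → H_ij` as `ε → 0`, where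
`H_ij = (1/n) Aᵢ eⱼ (yᵢ'/‖yᵢ‖) + (1/n) (yᵢ/‖yᵢ‖) eⱼ' Aᵢ − (1/n) ∑ ℓ A_ℓ G⁻¹ Aᵢ eⱼ (y_ℓ'/‖y_ℓ‖)
− (1/n) ∑ ℓ (y_ℓ/‖y_ℓ‖) eⱼ' Aᵢ G⁻¹ A_ℓ`, with `y ℓ = x ℓ − t₀`,
`A ℓ = ‖y ℓ‖⁻¹ (I_p − y ℓ (y ℓ)'/‖y ℓ‖²)` and `G = ∑ ℓ A ℓ`. -/
theorem stmt_8 (n p : ℕ) (x : Fin n → EuclideanSpace ℝ (Fin p))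
    (hline : ¬ ∃ (a v : EuclideanSpace ℝ (Fin p)), ∀ ℓ, ∃ c : ℝ, x ℓ = a + c • v)
    (t₀ : EuclideanSpace ℝ (Fin p))
    (ht₀ : ∀ t : EuclideanSpace ℝ (Fin p), ∑ ℓ, ‖x ℓ - t₀‖ ≤ ∑ ℓ, ‖x ℓ - t‖)
    (hne : ∀ ℓ, t₀ ≠ x ℓ)
    (i : Fin n) (j : Fin p)
    (tm : ℝ → EuclideanSpace ℝ (Fin p))
    (htm : ∀ ε : ℝ, ∀ t : EuclideanSpace ℝ (Fin p),
      ∑ ℓ, ‖eperturb n p x i j ε ℓ - tm ε‖ ≤ ∑ ℓ, ‖eperturb n p x i j ε ℓ - t‖)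
    (y : Fin n → EuclideanSpace ℝ (Fin p)) (hy : ∀ ℓ, y ℓ = x ℓ - t₀)
    (A : Fin n → Matrix (Fin p) (Fin p) ℝ)
    (hA : ∀ ℓ, A ℓ = ‖y ℓ‖⁻¹ • ((1 : Matrix (Fin p) (Fin p) ℝ)
      - (‖y ℓ‖ ^ 2)⁻¹ • Matrix.vecMulVec (fun r => y ℓ r) (fun r => y ℓ r)))
    (G : Matrix (Fin p) (Fin p) ℝ) (hG : G = ∑ ℓ, A ℓ) :
    Tendsto
      (fun ε : ℝ => ε⁻¹ • (sscm n p (eperturb n p x i j ε) (tm ε) - sscm n p x t₀))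
      (nhdsWithin 0 {0}ᶜ)
      (nhds (
        (n : ℝ)⁻¹ • Matrix.vecMulVec ((A i).mulVec (Pi.single j 1 : Fin p → ℝ)) (sgn (y i))
        + (n : ℝ)⁻¹ • Matrix.vecMulVec (sgn (y i))
            (Matrix.vecMul (Pi.single j 1 : Fin p → ℝ) (A i))
        - (n : ℝ)⁻¹ • ∑ ℓ, Matrix.vecMulVec
            ((A ℓ * G⁻¹ * A i).mulVec (Pi.single j 1 : Fin p → ℝ)) (sgn (y ℓ))
        - (n : ℝ)⁻¹ • ∑ ℓ, Matrix.vecMulVec (sgn (y ℓ))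
            (Matrix.vecMul (Pi.single j 1 : Fin p → ℝ) (A i * G⁻¹ * A ℓ)))) := by
  have hey : ∀ ℓ, x ℓ - t₀ ≠ 0 := fun ℓ => sub_ne_zero.mpr (hne ℓ).symm
  obtain rfl : y = fun ℓ => x ℓ - t₀ := funext hy
  set w : Fin n → EuclideanSpace ℝ (Fin p) := Pi.single i (EuclideanSpace.single j (1 : ℝ)) with hw
  simp only [eperturb_apply, ← hw] at htm
  obtain ⟨htm0, d, hd, hdeq⟩ := exists_hasDerivAt_spatialMedian hline ht₀ hey htm
  have hmul : ∀ ℓ v, A ℓ *ᵥ WithLp.ofLp v = (normalizeDeriv (x ℓ - t₀) v).ofLp := fun ℓ v => by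
    rw [hA ℓ, mulVec_eq_normalizeDeriv]
  have hsymm : ∀ ℓ, (A ℓ)ᵀ = A ℓ := fun ℓ => by
    simp [hA ℓ, transpose_vecMulVec]
  have hGmul : ∀ v : EuclideanSpace ℝ (Fin p),
      G *ᵥ v.ofLp = (∑ ℓ, normalizeDeriv (x ℓ - t₀) v).ofLp := fun v => by
    rw [hG, sum_mulVec, WithLp.ofLp_sum]
    exact Finset.sum_congr rfl fun ℓ _ => hmul ℓ v
  have hGunit : IsUnit G := by
    rw [← mulVec_injective_iff_isUnit]
    intro a b hab
    refine (WithLp.toLp_injective 2) (sum_normalizeDeriv_injective hline hey ?_)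
    rw [_root_.sum_apply, _root_.sum_apply]
    exact WithLp.ofLp_injective 2 (by rw [← hGmul, ← hGmul]; exact hab)
  have hdG : d.ofLp = G⁻¹ *ᵥ (A i *ᵥ (Pi.single j 1 : Fin p → ℝ)) := by
    have h : G *ᵥ d.ofLp = A i *ᵥ (Pi.single j 1 : Fin p → ℝ) := by
      rw [hGmul, hdeq, Finset.sum_eq_single i (fun ℓ _ hℓ => by simp [w, hℓ]) (by simp), ← hmul]
      simp [w]
    rw [← h, mulVec_mulVec, nonsing_inv_mul _ ((isUnit_iff_isUnit_det G).mp hGunit), one_mulVec]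
  have hU : ∀ ℓ r, HasDerivAt (fun ε => sgn (eperturb n p x i j ε ℓ - tm ε) r)
      ((A ℓ *ᵥ (w ℓ).ofLp) r - (A ℓ *ᵥ d.ofLp) r) 0 := fun ℓ r => by
    have h1 : HasDerivAt (fun ε : ℝ => x ℓ + ε • w ℓ - tm ε) (w ℓ - d) 0 := by
      simpa only [one_smul, id_eq] using
        (((hasDerivAt_id (0 : ℝ)).smul_const (w ℓ)).const_add (x ℓ)).fun_sub hd
    have h2 : HasFDerivAt (fun v : EuclideanSpace ℝ (Fin p) => ‖v‖⁻¹ • v)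
        (normalizeDeriv (x ℓ - t₀)) (x ℓ + (0 : ℝ) • w ℓ - tm 0) := by
      simpa [htm0] using (hasStrictFDerivAt_normalize (hey ℓ)).hasFDerivAt
    have h3 := (EuclideanSpace.proj r : EuclideanSpace ℝ (Fin p) →L[ℝ] ℝ).hasFDerivAt.comp_hasDerivAt
      (0 : ℝ) (h2.comp_hasDerivAt (0 : ℝ) h1)
    refine (h3.congr_deriv ?_).congr_of_eventuallyEq (Eventually.of_forall fun ε => ?_)
    · rw [hmul, hmul, map_sub]
      rfl
    · beta_reduce
      rw [eperturb_apply, ← hw]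
      rfl
  refine tendsto_pi_nhds.mpr fun r => tendsto_pi_nhds.mpr fun s => ?_
  have hS := (HasDerivAt.fun_sum (u := Finset.univ) fun ℓ _ =>
    (hU ℓ r).fun_mul (hU ℓ s)).const_mul (n : ℝ)⁻¹
  have hbase : eperturb n p x i j 0 = x := funext fun ℓ => by simp [eperturb_apply]
  have hlim := hasDerivAt_iff_tendsto_slope_zero.mp hS
  simp only [zero_add, hbase, htm0] at hlim
  refine Tendsto.mono_right (hlim.congr fun ε => ?_) (congrArg 𝓝 (Eq.symm ?_)).le
  · simp [sscm, Matrix.sum_apply, vecMulVec_apply]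
  have hvec : ∀ M : Matrix (Fin p) (Fin p) ℝ, (Pi.single j 1 : Fin p → ℝ) ᵥ* M
      = Mᵀ *ᵥ (Pi.single j 1 : Fin p → ℝ) := fun M => (mulVec_transpose M _).symm
  have hGsymm : Gᵀ = G := by simp [hG, transpose_sum, hsymm]
  have hAd : ∀ ℓ, (A ℓ * G⁻¹ * A i) *ᵥ (Pi.single j 1 : Fin p → ℝ) = A ℓ *ᵥ d.ofLp := fun ℓ => by
    rw [hdG, mulVec_mulVec, mulVec_mulVec, Matrix.mul_assoc]
  have htr : ∀ ℓ, (A i * G⁻¹ * A ℓ)ᵀ = A ℓ * G⁻¹ * A i := fun ℓ => by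
    rw [transpose_mul, transpose_mul, transpose_nonsing_inv, hGsymm, hsymm, hsymm,
      Matrix.mul_assoc]
  have hsum : ∀ a b, ∑ ℓ, (A ℓ *ᵥ (w ℓ).ofLp) a * sgn (x ℓ - t₀) b
      = (A i *ᵥ (Pi.single j 1 : Fin p → ℝ)) a * sgn (x i - t₀) b := fun a b => by
    rw [Finset.sum_eq_single i (fun ℓ _ hℓ => by simp [w, hℓ]) (by simp)]
    simp [w]
  have hterm : ∀ ℓ, ((A ℓ *ᵥ (w ℓ).ofLp) r - (A ℓ *ᵥ d.ofLp) r) * sgn (x ℓ - t₀) s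
      + sgn (x ℓ - t₀) r * ((A ℓ *ᵥ (w ℓ).ofLp) s - (A ℓ *ᵥ d.ofLp) s)
      = (A ℓ *ᵥ (w ℓ).ofLp) r * sgn (x ℓ - t₀) s + (A ℓ *ᵥ (w ℓ).ofLp) s * sgn (x ℓ - t₀) r
        - (A ℓ *ᵥ d.ofLp) r * sgn (x ℓ - t₀) s - sgn (x ℓ - t₀) r * (A ℓ *ᵥ d.ofLp) s :=
    fun ℓ => by ring
  simp only [hterm, Finset.sum_sub_distrib, Finset.sum_add_distrib, hsum]
  simp only [hvec, htr, hAd, hsymm, Matrix.add_apply, Matrix.sub_apply, Matrix.smul_apply,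
    Matrix.sum_apply, vecMulVec_apply, smul_eq_mul]
  ring
end
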